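/- In the 2-block stochastic block model with p ≥ Ω(log²n / n) and p > q, the centered adjacency matrix R = A − E[A] satisfies ‖R‖ ≤ O(√(np)) in spectral norm with probability 1 − n^{−Ω(1)}. -/

import Mathlib

open MeasureTheory ProbabilityTheory Matrix

/-- Bernoulli measure on `Bool` with success probability `p`. -/
noncomputable def bern (p : ℝ) : Measure Bool :=
  ENNReal.ofReal (1 - p) • Measure.dirac false + ENNReal.ofReal p • Measure.dirac true

/-- Edge randomness of the 2-block stochastic block model on `n` vertices:
independent Bernoulli variables, with probability `p` for pairs inside a class and `q`
across classes.  Class `S` consists of the first `n/2` vertices; only the upper triangle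
is used to build the (symmetric) adjacency matrix. -/
noncomputable def sbm (n : ℕ) (p q : ℝ) : Measure (Fin n → Fin n → Bool) :=
  Measure.pi fun i => Measure.pi fun j =>
    bern (if ((i : ℕ) < n / 2 ↔ (j : ℕ) < n / 2) then p else q)

/-- The (symmetric, hollow) adjacency matrix built from the edge indicators. -/
noncomputable def adjM {n : ℕ} (ω : Fin n → Fin n → Bool) : Matrix (Fin n) (Fin n) ℝ :=
  Matrix.of fun i j =>
    if i = j then 0 else if (if i ≤ j then ω i j else ω j i) then 1 else 0

/-- Empirical average degree `d = 2|E|/n`. -/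
noncomputable def avgDeg {n : ℕ} (ω : Fin n → Fin n → Bool) : ℝ :=
  (∑ i, ∑ j, adjM ω i j) / n

/-- Corrected graph convolution matrix `Ã = (1/d)A - (1/n)𝟙𝟙ᵀ`. -/
noncomputable def tildeA {n : ℕ} (ω : Fin n → Fin n → Bool) : Matrix (Fin n) (Fin n) ℝ :=
  (avgDeg ω)⁻¹ • adjM ω - (n : ℝ)⁻¹ • Matrix.of (fun _ _ => (1 : ℝ))

/-- The unit signal vector `s`, with entries `1/√n` on `S` and `-1/√n` on `T`. -/
noncomputable def sig (n : ℕ) : Fin n → ℝ :=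
  fun i => if (i : ℕ) < n / 2 then (Real.sqrt n)⁻¹ else -(Real.sqrt n)⁻¹

/-- Spectral norm (ℓ²→ℓ² operator norm) of a real square matrix. -/
noncomputable def specNorm {n : ℕ} (M : Matrix (Fin n) (Fin n) ℝ) : ℝ :=
  ‖Matrix.toEuclideanCLM (𝕜 := ℝ) M‖

/-- Entrywise expectation of the adjacency matrix in the 2-block SBM:
`p` within classes, `q` across classes. -/
noncomputable def expAdj (n : ℕ) (p q : ℝ) : Matrix (Fin n) (Fin n) ℝ :=
  Matrix.of fun i j => if ((i : ℕ) < n / 2 ↔ (j : ℕ) < n / 2) then p else q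


/-- A kernel comparable to `min y y⁻¹`, whose sums over dyadic scales telescope. -/
noncomputable def dyadicKernel (y : ℝ) : ℝ := y / ((1 + y) * (1 + 2 * y))

theorem dyadicKernel_pos {y : ℝ} (hy : 0 < y) : 0 < dyadicKernel y := by
  unfold dyadicKernel; positivity

theorem sum_dyadicKernel_mul_two_pow_le (L : ℕ) {z : ℝ} (hz : 0 < z) :
    ∑ k ∈ Finset.range L, dyadicKernel (z * 2 ^ k) ≤ 1 := by
  have key : ∀ k : ℕ, dyadicKernel (z * 2 ^ k) =
      z * 2 ^ (k + 1) / (1 + z * 2 ^ (k + 1)) - z * 2 ^ k / (1 + z * 2 ^ k) := by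
    intro k
    have h : 0 < z * 2 ^ k := by positivity
    rw [show z * 2 ^ (k + 1) = 2 * (z * 2 ^ k) by ring]
    generalize z * 2 ^ k = y at *
    unfold dyadicKernel
    field_simp
    ring
  simp_rw [key]
  rw [Finset.sum_range_sub (fun k => z * 2 ^ k / (1 + z * 2 ^ k))]
  have h1 : z * 2 ^ L / (1 + z * 2 ^ L) ≤ 1 := by
    rw [div_le_one (by positivity)]; linarith
  have h2 : 0 ≤ z * 2 ^ 0 / (1 + z * 2 ^ 0) := by positivity
  linarith

theorem sum_dyadicKernel_div_two_pow_le (L : ℕ) {z : ℝ} (hz : 0 < z) :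
    ∑ k ∈ Finset.range L, dyadicKernel (z / 2 ^ k) ≤ 1 := by
  rw [← Finset.sum_range_reflect]
  refine le_of_eq_of_le (Finset.sum_congr rfl fun k hk => ?_)
    (sum_dyadicKernel_mul_two_pow_le L (z := z / 2 ^ (L - 1)) (by positivity))
  have : z / 2 ^ (L - 1 - k) = z / 2 ^ (L - 1) * 2 ^ k := by
    rw [Finset.mem_range] at hk
    rw [div_mul_eq_mul_div, div_eq_div_iff (by positivity) (by positivity), mul_assoc, ← pow_add]
    congr 2
    omega
  rw [this]

theorem le_dyadicKernel {y : ℝ} (hy : 0 < y) (hy1 : y ≤ 1) :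
    y ≤ 6 * dyadicKernel y := by
  rw [dyadicKernel, ← mul_div_assoc, le_div_iff₀ (by positivity)]
  have : (1 + y) * (1 + 2 * y) ≤ 6 := by nlinarith
  nlinarith

theorem inv_le_dyadicKernel {y : ℝ} (hy1 : 1 ≤ y) :
    y⁻¹ ≤ 6 * dyadicKernel y := by
  have : 0 < y := by linarith
  rw [dyadicKernel, ← mul_div_assoc, le_div_iff₀ (by positivity), inv_mul_le_iff₀ this]
  nlinarith

theorem mul_le_one_add_pow_four_mul_exp {y l : ℝ} (hy : 0 ≤ y) :
    y * l ≤ 8 + 24 * (y ^ 4 * Real.exp (l / 2 - 1)) := by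
  have h1 : l ≤ 8 * Real.exp (l / 8) := by
    have := Real.add_one_le_exp (l / 8); linarith
  have h2 : Real.exp (l / 2) = Real.exp (l / 8) ^ 4 := by
    rw [← Real.exp_nat_mul]; congr 1; push_cast; ring
  have h3 : Real.exp (l / 2) ≤ 3 * Real.exp (l / 2 - 1) := by
    rw [show l / 2 = 1 + (l / 2 - 1) by ring, Real.exp_add]
    have := Real.exp_one_lt_d9
    have h := Real.exp_pos (l / 2 - 1)
    ring_nf at *
    nlinarith
  have hw := Real.exp_pos (l / 8)
  set w := Real.exp (l / 8)
  have h4 : y * w ≤ 1 + (y * w) ^ 4 := by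
    nlinarith [sq_nonneg ((y * w) ^ 2 - 1 / 2), sq_nonneg (y * w - 1 / 2)]
  have h5 : y ^ 4 * Real.exp (l / 2) ≤ y ^ 4 * (3 * Real.exp (l / 2 - 1)) := by gcongr
  rw [h2] at h5
  have h6 : y * l ≤ y * (8 * w) := by gcongr
  nlinarith

/-- Bound on the contribution of a pair of levels, in terms of their sizes `s ≥ t`, magnitudes
`A ^ 2`, `B ^ 2`, and the number `e` of edges between them. -/
theorem level_pair_bound {n p δ s t A B e l : ℝ} (hδ : 0 < δ) (hp : 0 < p)
    (hd : n * p = δ ^ 4) (hs : 0 < s) (ht : 0 < t) (hA : 0 < A) (hB : 0 < B)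
    (hl : 1 ≤ l) (hsl : n = s * Real.exp (l - 1))
    (h1 : e ≤ 3 * (p * s * t) + 6 * (s * l))
    (h2 : e * l ≤ 2 * (p * s * t * Real.exp (l / 2) + 6 * (s * l)))
    (h3 : e ≤ 4 * δ ^ 4 * t) (heavy : δ ^ 2 ≤ 16 * (A ^ 2 * B ^ 2)) :
    A ^ 2 * B ^ 2 * e ≤ 864 * (δ ^ 2 * (A ^ 4 * s + B ^ 4 * t) *
        dyadicKernel (B / (A * δ))) +
      48 * (p / δ ^ 2 * (A ^ 4 * B ^ 4 * s * t)) := by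
  obtain ⟨y, hy⟩ : ∃ y, y = B / (A * δ) := ⟨_, rfl⟩
  have hy0 : 0 < y := by rw [hy]; positivity
  have hB' : B = A * δ * y := by rw [hy]; field_simp
  rw [← hy]
  obtain ⟨g, hg⟩ : ∃ g, g = dyadicKernel y := ⟨_, rfl⟩
  have hg0 : 0 < g := by rw [hg]; exact dyadicKernel_pos hy0
  rw [← hg]
  have hlast : 0 ≤ p / δ ^ 2 * (A ^ 4 * B ^ 4 * s * t) := by positivity
  have hg_s : 0 ≤ δ ^ 2 * (A ^ 4 * s) * g := by positivity
  have hg_t : 0 ≤ δ ^ 2 * (B ^ 4 * t) * g := by positivity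
  rcases le_total y 1 with hy1 | hy1
  · have hyg : y ≤ 6 * g := hg ▸ le_dyadicKernel hy0 hy1
    rcases le_or_gt (p * t * Real.exp (l / 2)) 1 with hc | hc
    · have he' : e ≤ 14 * s := by
        have : e * l ≤ 14 * s * l := by
          have : p * s * t * Real.exp (l / 2) ≤ s * l := by
            calc p * s * t * Real.exp (l / 2) = s * (p * t * Real.exp (l / 2)) := by ring
              _ ≤ s * l := by gcongr; linarith
          linarith
        exact le_of_mul_le_mul_right this (by linarith)
      have : A ^ 2 * B ^ 2 * e ≤ 14 * (δ ^ 2 * (A ^ 4 * s)) * y := by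
        calc A ^ 2 * B ^ 2 * e ≤ A ^ 2 * B ^ 2 * (14 * s) := by gcongr
          _ = 14 * (δ ^ 2 * (A ^ 4 * s)) * (y * y) := by rw [hB']; ring
          _ ≤ 14 * (δ ^ 2 * (A ^ 4 * s)) * (y * 1) := by gcongr
          _ = _ := by ring
      have h' : 14 * (δ ^ 2 * (A ^ 4 * s)) * y ≤ 14 * (δ ^ 2 * (A ^ 4 * s)) * (6 * g) := by
        gcongr
      nlinarith
    · have hdt : s * Real.exp (l / 2 - 1) ≤ δ ^ 4 * t := by
        have e1 : Real.exp (l - 1) = Real.exp (l / 2 - 1) * Real.exp (l / 2) := by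
          rw [← Real.exp_add]; congr 1; ring
        have := Real.exp_pos (l / 2)
        have h0 := Real.exp_pos (l / 2 - 1)
        rw [← hd, hsl, e1]
        have : s * Real.exp (l / 2 - 1) * 1 ≤
            s * Real.exp (l / 2 - 1) * (p * t * Real.exp (l / 2)) := by gcongr
        linarith
      have hyl : A ^ 4 * (s * (y * l)) ≤ 24 * (A ^ 4 * s + B ^ 4 * t) := by
        have hm := mul_le_one_add_pow_four_mul_exp (l := l) hy0.le
        have : s * (y * l) ≤ 8 * s + 24 * (y ^ 4 * (δ ^ 4 * t)) := by
          calc s * (y * l) ≤ s * (8 + 24 * (y ^ 4 * Real.exp (l / 2 - 1))) := by gcongr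
            _ = 8 * s + 24 * (y ^ 4 * (s * Real.exp (l / 2 - 1))) := by ring
            _ ≤ _ := by gcongr
        calc A ^ 4 * (s * (y * l)) ≤ A ^ 4 * (8 * s + 24 * (y ^ 4 * (δ ^ 4 * t))) := by gcongr
          _ = 8 * (A ^ 4 * s) + 24 * (B ^ 4 * t) := by rw [hB']; ring
          _ ≤ _ := by
            have : 0 < A ^ 4 * s := by positivity
            linarith
      have hheavy : A ^ 2 * B ^ 2 * (p * s * t) ≤ 16 * (p / δ ^ 2 * (A ^ 4 * B ^ 4 * s * t)) := by
        have : 16 * (p / δ ^ 2 * (A ^ 4 * B ^ 4 * s * t)) =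
            A ^ 2 * B ^ 2 * (p * s * t) * (16 * (A ^ 2 * B ^ 2) / δ ^ 2) := by
          field_simp
        rw [this]
        refine le_mul_of_one_le_right (by positivity) ?_
        rw [one_le_div (by positivity)]; exact heavy
      have hmain : A ^ 2 * B ^ 2 * (s * l) ≤ 24 * (δ ^ 2 * (A ^ 4 * s + B ^ 4 * t)) * (6 * g) := by
        calc A ^ 2 * B ^ 2 * (s * l) = δ ^ 2 * (A ^ 4 * (s * (y * l))) * y := by rw [hB']; ring
          _ ≤ δ ^ 2 * (24 * (A ^ 4 * s + B ^ 4 * t)) * (6 * g) := by gcongr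
          _ = _ := by ring
      calc A ^ 2 * B ^ 2 * e ≤ A ^ 2 * B ^ 2 * (3 * (p * s * t) + 6 * (s * l)) := by gcongr
        _ = 3 * (A ^ 2 * B ^ 2 * (p * s * t)) + 6 * (A ^ 2 * B ^ 2 * (s * l)) := by ring
        _ ≤ _ := by linarith
  · have hyg : y⁻¹ ≤ 6 * g := hg ▸ inv_le_dyadicKernel hy1
    have : A ^ 2 * B ^ 2 * e ≤ 4 * (δ ^ 2 * (B ^ 4 * t)) * y⁻¹ := by
      calc A ^ 2 * B ^ 2 * e ≤ A ^ 2 * B ^ 2 * (4 * δ ^ 4 * t) := by gcongr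
        _ = 4 * (δ ^ 2 * (B ^ 4 * t)) * (y⁻¹ * y⁻¹) := by rw [hy]; field_simp
        _ ≤ 4 * (δ ^ 2 * (B ^ 4 * t)) * (y⁻¹ * 1) := by
          gcongr
          exact inv_le_one_of_one_le₀ hy1
        _ = _ := by ring
    have h' : 4 * (δ ^ 2 * (B ^ 4 * t)) * y⁻¹ ≤ 4 * (δ ^ 2 * (B ^ 4 * t)) * (6 * g) := by
      gcongr
    nlinarith

/-- The entries of the nonnegative array `B` are spread out like those of a random 0/1 matrix with
edge probabilities at most `p`: row and column sums are `O(n * p)`, and the number of edges between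
any two vertex sets is controlled. -/
structure HasBoundedDiscrepancy {n : ℕ} (B : Fin n → Fin n → ℝ) (p : ℝ) : Prop where
  nonneg : ∀ i j, 0 ≤ B i j
  row_sum : ∀ i, ∑ j, B i j ≤ 4 * (n * p)
  col_sum : ∀ j, ∑ i, B i j ≤ 4 * (n * p)
  linear : ∀ S T : Finset (Fin n), S.Nonempty → T.Nonempty → ∀ m : ℕ, m = max S.card T.card →
    ∑ i ∈ S, ∑ j ∈ T, B i j ≤
      3 * (p * S.card * T.card) + 6 * (m * (1 + Real.log (n / m)))
  poisson : ∀ S T : Finset (Fin n), S.Nonempty → T.Nonempty → ∀ m : ℕ, m = max S.card T.card →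
    (∑ i ∈ S, ∑ j ∈ T, B i j) * (1 + Real.log (n / m)) ≤
      2 * (p * S.card * T.card * Real.exp ((1 + Real.log (n / m)) / 2) +
        6 * (m * (1 + Real.log (n / m))))

theorem HasBoundedDiscrepancy.transpose {n : ℕ} {B : Fin n → Fin n → ℝ} {p : ℝ}
    (h : HasBoundedDiscrepancy B p) : HasBoundedDiscrepancy (fun i j => B j i) p where
  nonneg i j := h.nonneg j i
  row_sum := h.col_sum
  col_sum := h.row_sum
  linear S T hS hT m hm := by
    have := h.linear T S hT hS m (by rw [hm, max_comm])
    rw [Finset.sum_comm]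
    linarith
  poisson S T hS hT m hm := by
    have := h.poisson T S hT hS m (by rw [hm, max_comm])
    rw [Finset.sum_comm]
    rw [mul_right_comm p]
    exact this

theorem HasBoundedDiscrepancy.level_pair_bound_of_card_le {n : ℕ} {B : Fin n → Fin n → ℝ}
    {p δ : ℝ} (h : HasBoundedDiscrepancy B p) (hδ : 0 < δ) (hp : 0 < p) (hd : n * p = δ ^ 4)
    {S T : Finset (Fin n)} (hS : S.Nonempty) (hT : T.Nonempty) (hST : T.card ≤ S.card) {x y : ℝ}
    (hx : 0 < x) (hy : 0 < y) (heavy : δ ^ 2 ≤ 16 * (x ^ 2 * y ^ 2)) :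
    x ^ 2 * y ^ 2 * (∑ i ∈ S, ∑ j ∈ T, B i j) ≤
      864 * (δ ^ 2 * (x ^ 4 * S.card + y ^ 4 * T.card) *
        dyadicKernel (y / (x * δ))) +
      48 * (p / δ ^ 2 * (x ^ 4 * y ^ 4 * S.card * T.card)) := by
  have hs : (0 : ℝ) < S.card := by exact_mod_cast hS.card_pos
  have ht : (0 : ℝ) < T.card := by exact_mod_cast hT.card_pos
  have hsn : (S.card : ℝ) ≤ n := by exact_mod_cast (card_finset_fin_le S)
  refine level_pair_bound (n := n) (l := 1 + Real.log (n / S.card)) hδ hp hd hs ht hx hy ?_ ?_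
    (h.linear S T hS hT _ (max_eq_left hST).symm) (h.poisson S T hS hT _ (max_eq_left hST).symm)
    ?_ heavy
  · have := Real.log_nonneg ((one_le_div hs).2 hsn)
    linarith
  · rw [add_sub_cancel_left, Real.exp_log (div_pos (hs.trans_le hsn) hs)]
    field_simp
  · rw [Finset.sum_comm, ← hd]
    calc ∑ j ∈ T, ∑ i ∈ S, B i j ≤ ∑ j ∈ T, 4 * (n * p) :=
          Finset.sum_le_sum fun j _ => (Finset.sum_le_univ_sum_of_nonneg
            fun i => h.nonneg i j).trans (h.col_sum j)
      _ = _ := by rw [Finset.sum_const, nsmul_eq_mul]; ring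

theorem HasBoundedDiscrepancy.level_pair_bound {n : ℕ} {B : Fin n → Fin n → ℝ}
    {p δ : ℝ} (h : HasBoundedDiscrepancy B p) (hδ : 0 < δ) (hp : 0 < p) (hd : n * p = δ ^ 4)
    (S T : Finset (Fin n)) {x y : ℝ}
    (hx : 0 < x) (hy : 0 < y) (heavy : δ ^ 2 ≤ 16 * (x ^ 2 * y ^ 2)) :
    x ^ 2 * y ^ 2 * (∑ i ∈ S, ∑ j ∈ T, B i j) ≤
      864 * (δ ^ 2 * (x ^ 4 * S.card + y ^ 4 * T.card) *
        (dyadicKernel (y / (x * δ)) +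
          dyadicKernel (x / (y * δ)))) +
      48 * (p / δ ^ 2 * (x ^ 4 * y ^ 4 * S.card * T.card)) := by
  have hk1 := dyadicKernel_pos (y := y / (x * δ)) (by positivity)
  have hk2 := dyadicKernel_pos (y := x / (y * δ)) (by positivity)
  have h1 : 0 ≤ 864 * (δ ^ 2 * (x ^ 4 * S.card + y ^ 4 * T.card) *
    dyadicKernel (y / (x * δ))) := by positivity
  have h2 : 0 ≤ 864 * (δ ^ 2 * (x ^ 4 * S.card + y ^ 4 * T.card) *
    (dyadicKernel (x / (y * δ)))) := by positivity
  have h3 : 0 ≤ 48 * (p / δ ^ 2 * (x ^ 4 * y ^ 4 * S.card * T.card)) := by positivity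
  rw [mul_add (δ ^ 2 * _), mul_add (864 : ℝ)]
  rcases S.eq_empty_or_nonempty with rfl | hS
  · simp only [Finset.sum_empty, mul_zero]; linarith
  rcases T.eq_empty_or_nonempty with rfl | hT
  · simp only [Finset.sum_empty, Finset.sum_const_zero, mul_zero] at *; linarith
  rcases le_total T.card S.card with hc | hc
  · have := h.level_pair_bound_of_card_le hδ hp hd hS hT hc hx hy heavy
    linarith
  · have := h.transpose.level_pair_bound_of_card_le hδ hp hd hT hS hc hy hx
      (by rw [mul_comm (y ^ 2)]; exact heavy)
    rw [Finset.sum_comm] at this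
    rw [mul_comm (y ^ 2), add_comm (y ^ 4 * _), mul_comm (y ^ 4) (x ^ 4),
      mul_right_comm (x ^ 4 * y ^ 4)] at this
    linarith

/-- The indices `i` with `4 ^ a ≤ |u i| < 4 ^ (a + 1)`. -/
def levelSet {n : ℕ} (u : Fin n → ℤ) (a : ℕ) : Finset (Fin n) :=
  {i | u i ≠ 0 ∧ Nat.log 4 (u i).natAbs = a}

theorem sum_levelSet_card_le {n : ℕ} (u : Fin n → ℤ) (L : ℕ) :
    ∑ a ∈ Finset.range L, ((2 : ℝ) ^ a) ^ 4 * (levelSet u a).card ≤ ∑ i, (u i : ℝ) ^ 2 := by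
  have h1 : ∀ a, ((2 : ℝ) ^ a) ^ 4 * (levelSet u a).card ≤
      ∑ i with Nat.log 4 (u i).natAbs = a, (u i : ℝ) ^ 2 := by
    intro a
    calc ((2 : ℝ) ^ a) ^ 4 * (levelSet u a).card = ∑ i ∈ levelSet u a, ((2 : ℝ) ^ a) ^ 4 := by
          rw [Finset.sum_const, nsmul_eq_mul, mul_comm]
      _ ≤ ∑ i ∈ levelSet u a, (u i : ℝ) ^ 2 := by
          refine Finset.sum_le_sum fun i hi => ?_
          obtain ⟨h0, ha⟩ := (Finset.mem_filter.1 hi).2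
          have h4 : 4 ^ a ≤ (u i).natAbs :=
            ha ▸ Nat.pow_log_le_self 4 (Int.natAbs_ne_zero.2 h0)
          have h5 : (4 : ℝ) ^ a ≤ |(u i : ℝ)| := by
            rw [← Int.cast_abs, Int.abs_eq_natAbs]; exact_mod_cast h4
          calc ((2 : ℝ) ^ a) ^ 4 = (4 ^ a) ^ 2 := by
                rw [show (4 : ℝ) = 2 ^ 2 by norm_num, ← pow_mul, ← pow_mul, ← pow_mul]
                congr 1; ring
            _ ≤ |(u i : ℝ)| ^ 2 := by gcongr
            _ = _ := sq_abs _
      _ ≤ _ := Finset.sum_le_sum_of_subset_of_nonneg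
          (fun i hi => Finset.mem_filter.2 ⟨Finset.mem_univ _, (Finset.mem_filter.1 hi).2.2⟩)
          fun i _ _ => sq_nonneg _
  calc _ ≤ ∑ a ∈ Finset.range L, ∑ i with Nat.log 4 (u i).natAbs = a, (u i : ℝ) ^ 2 :=
        Finset.sum_le_sum fun a _ => h1 a
    _ ≤ _ := by
      simp_rw [Finset.sum_filter]
      rw [Finset.sum_comm]
      refine Finset.sum_le_sum fun i _ => ?_
      rw [Finset.sum_ite_eq]
      split_ifs
      · exact le_rfl
      · positivity

theorem heavy_sum_le_sum_levels {n : ℕ} {B : Fin n → Fin n → ℝ} (hB : ∀ i j, 0 ≤ B i j)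
    {r : ℝ} (hr : 0 ≤ r) (u v : Fin n → ℤ) {L : ℕ} (hu : ∀ i, Nat.log 4 (u i).natAbs < L)
    (hv : ∀ j, Nat.log 4 (v j).natAbs < L) :
    ∑ i, ∑ j, (if r < |(u i * v j : ℝ)| then B i j * |(u i * v j : ℝ)| else 0) ≤
      ∑ a ∈ Finset.range L, ∑ b ∈ Finset.range L,
        if r ≤ 16 * (((2 : ℝ) ^ a) ^ 2 * (2 ^ b) ^ 2) then
          16 * (((2 : ℝ) ^ a) ^ 2 * (2 ^ b) ^ 2 *
            ∑ i ∈ levelSet u a, ∑ j ∈ levelSet v b, B i j) else 0 := by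
  set G : ℕ → ℕ → Fin n → Fin n → ℝ := fun a b i j =>
    if r ≤ 16 * (((2 : ℝ) ^ a) ^ 2 * (2 ^ b) ^ 2) then
      16 * (((2 : ℝ) ^ a) ^ 2 * (2 ^ b) ^ 2 *
        if i ∈ levelSet u a then if j ∈ levelSet v b then B i j else 0 else 0) else 0 with hG
  have hG0 : ∀ a b i j, 0 ≤ G a b i j := by
    intro a b i j
    have := hB i j
    simp only [hG]
    split_ifs <;> positivity
  have key : ∀ i j, (if r < |(u i * v j : ℝ)| then B i j * |(u i * v j : ℝ)| else 0) ≤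
      ∑ a ∈ Finset.range L, ∑ b ∈ Finset.range L, G a b i j := by
    intro i j
    split_ifs with hr'
    · have h0 : (u i * v j : ℝ) ≠ 0 := by
        intro h0; rw [h0, abs_zero] at hr'; linarith
      have hu0 : u i ≠ 0 := by rintro h; simp [h] at h0
      have hv0 : v j ≠ 0 := by rintro h; simp [h] at h0
      have bound : ∀ z : ℤ, |(z : ℝ)| ≤ 4 * ((2 : ℝ) ^ Nat.log 4 z.natAbs) ^ 2 := by
        intro z
        have := (Nat.lt_pow_succ_log_self (b := 4) (by norm_num) z.natAbs).le
        have h5 : |(z : ℝ)| ≤ (4 : ℝ) ^ (Nat.log 4 z.natAbs + 1) := by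
          rw [← Int.cast_abs, Int.abs_eq_natAbs]; exact_mod_cast this
        refine h5.trans_eq ?_
        rw [← pow_mul, mul_comm _ 2, pow_mul]; norm_num; ring
      have huv : |(u i * v j : ℝ)| ≤ 16 * (((2 : ℝ) ^ Nat.log 4 (u i).natAbs) ^ 2 *
          (2 ^ Nat.log 4 (v j).natAbs) ^ 2) := by
        rw [abs_mul]
        calc _ ≤ (4 * ((2 : ℝ) ^ Nat.log 4 (u i).natAbs) ^ 2) *
              (4 * ((2 : ℝ) ^ Nat.log 4 (v j).natAbs) ^ 2) := by
              gcongr <;> exact bound _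
          _ = _ := by ring
      have hmem : G (Nat.log 4 (u i).natAbs) (Nat.log 4 (v j).natAbs) i j =
          16 * (((2 : ℝ) ^ Nat.log 4 (u i).natAbs) ^ 2 *
          (2 ^ Nat.log 4 (v j).natAbs) ^ 2 * B i j) := by
        simp only [hG]
        rw [if_pos (hr'.le.trans huv), if_pos, if_pos]
        · simp [levelSet, hv0]
        · simp [levelSet, hu0]
      calc B i j * |(u i * v j : ℝ)| ≤ B i j * _ := mul_le_mul_of_nonneg_left huv (hB i j)
        _ = G (Nat.log 4 (u i).natAbs) (Nat.log 4 (v j).natAbs) i j := by rw [hmem]; ring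
        _ ≤ ∑ b ∈ Finset.range L, G (Nat.log 4 (u i).natAbs) b i j :=
          Finset.single_le_sum (f := fun b => G (Nat.log 4 (u i).natAbs) b i j)
            (fun b _ => hG0 _ b i j) (Finset.mem_range.2 (hv j))
        _ ≤ _ := Finset.single_le_sum (f := fun a => ∑ b ∈ Finset.range L, G a b i j)
            (fun a _ => Finset.sum_nonneg fun b _ => hG0 a b i j) (Finset.mem_range.2 (hu i))
    · exact Finset.sum_nonneg fun a _ => Finset.sum_nonneg fun b _ => hG0 a b i j
  calc _ ≤ ∑ i, ∑ j, ∑ a ∈ Finset.range L, ∑ b ∈ Finset.range L, G a b i j :=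
        Finset.sum_le_sum fun i _ => Finset.sum_le_sum fun j _ => key i j
    _ = ∑ a ∈ Finset.range L, ∑ b ∈ Finset.range L, ∑ i, ∑ j, G a b i j := by
        rw [Finset.sum_congr rfl fun i _ => Finset.sum_comm, Finset.sum_comm]
        refine Finset.sum_congr rfl fun a _ => ?_
        rw [Finset.sum_congr rfl fun i _ => Finset.sum_comm, Finset.sum_comm]
    _ = _ := by
        refine Finset.sum_congr rfl fun a _ => Finset.sum_congr rfl fun b _ => ?_
        simp only [hG]
        split_ifs with hc
        · simp_rw [← Finset.mul_sum]
          congr 2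
          calc _ = ∑ i, if i ∈ levelSet u a then ∑ j ∈ levelSet v b, B i j else 0 :=
                Finset.sum_congr rfl fun i _ => by split_ifs <;> simp
            _ = _ := by rw [Finset.sum_ite_mem, Finset.univ_inter]
        · simp

theorem HasBoundedDiscrepancy.heavy_sum_le {n : ℕ} {B : Fin n → Fin n → ℝ} {p δ : ℝ}
    (h : HasBoundedDiscrepancy B p) (hδ : 0 < δ) (hp : 0 < p) (hd : n * p = δ ^ 4)
    {u v : Fin n → ℤ} (hu : ∑ i, (u i : ℝ) ^ 2 ≤ 9 * n) (hv : ∑ i, (v i : ℝ) ^ 2 ≤ 9 * n) :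
    ∑ i, ∑ j, (if δ ^ 2 < |(u i * v j : ℝ)| then B i j * |(u i * v j : ℝ)| else 0) ≤
      559872 * (n * δ ^ 2) := by
  obtain ⟨L, hL⟩ : ∃ L : ℕ, ∀ i,
      Nat.log 4 (u i).natAbs < L ∧ Nat.log 4 (v i).natAbs < L := by
    refine ⟨(∑ i, (Nat.log 4 (u i).natAbs + Nat.log 4 (v i).natAbs)) + 1, fun i => ?_⟩
    have : Nat.log 4 (u i).natAbs + Nat.log 4 (v i).natAbs ≤ _ := Finset.single_le_sum
      (f := fun i => Nat.log 4 (u i).natAbs + Nat.log 4 (v i).natAbs)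
      (fun i _ => Nat.zero_le _) (Finset.mem_univ i)
    omega
  refine (heavy_sum_le_sum_levels h.nonneg (by positivity) u v (fun i => (hL i).1)
    fun i => (hL i).2).trans ?_
  set α : ℕ → ℝ := fun a => ((2 : ℝ) ^ a) ^ 4 * (levelSet u a).card
  set β : ℕ → ℝ := fun b => ((2 : ℝ) ^ b) ^ 4 * (levelSet v b).card
  have hα0 : ∀ a, 0 ≤ α a := fun a => by positivity
  have hβ0 : ∀ a, 0 ≤ β a := fun a => by positivity
  have hα : ∑ a ∈ Finset.range L, α a ≤ 9 * n := (sum_levelSet_card_le u L).trans hu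
  have hβ : ∑ a ∈ Finset.range L, β a ≤ 9 * n := (sum_levelSet_card_le v L).trans hv
  set K : ℕ → ℕ → ℝ := fun a b => dyadicKernel (2 ^ b / (2 ^ a * δ)) + dyadicKernel (2 ^ a / (2 ^ b * δ))
  have hK0 : ∀ a b, 0 ≤ K a b := fun a b =>
    add_nonneg ((dyadicKernel_pos (by positivity)).le) ((dyadicKernel_pos (by positivity)).le)
  have hKsymm : ∀ a b, K a b = K b a := fun a b => add_comm _ _
  have hKsum : ∀ a, ∑ b ∈ Finset.range L, K a b ≤ 2 := by
    intro a
    have e1 := sum_dyadicKernel_mul_two_pow_le L (z := 1 / (2 ^ a * δ)) (by positivity)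
    have e2 := sum_dyadicKernel_div_two_pow_le L (z := 2 ^ a / δ) (by positivity)
    have e3 : ∀ b : ℕ, (2 : ℝ) ^ b / (2 ^ a * δ) = 1 / (2 ^ a * δ) * 2 ^ b := by
      intro b; ring
    have e4 : ∀ b : ℕ, (2 : ℝ) ^ a / (2 ^ b * δ) = 2 ^ a / δ / 2 ^ b := by
      intro b; field_simp
    simp only [K, Finset.sum_add_distrib, e3, e4]
    linarith
  have hpair : ∀ a b, (if δ ^ 2 ≤ 16 * (((2 : ℝ) ^ a) ^ 2 * (2 ^ b) ^ 2) then
          16 * (((2 : ℝ) ^ a) ^ 2 * (2 ^ b) ^ 2 *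
            ∑ i ∈ levelSet u a, ∑ j ∈ levelSet v b, B i j) else 0) ≤
      13824 * δ ^ 2 * (α a * K a b) + 13824 * δ ^ 2 * (β b * K b a) +
        768 * (p / δ ^ 2) * (α a * β b) := by
    intro a b
    have hα0 := hα0 a
    have hβ0 := hβ0 b
    split_ifs with hc
    · have := h.level_pair_bound hδ hp hd (levelSet u a) (levelSet v b)
        (x := 2 ^ a) (y := 2 ^ b) (by positivity) (by positivity) hc
      rw [hKsymm b a]
      simp only [α, β, K]
      linarith
    · have := hK0 a b
      have := hK0 b a
      positivity
  have sum_le : ∀ w : ℕ → ℝ, (∀ a, 0 ≤ w a) → ∑ a ∈ Finset.range L, w a ≤ 9 * n →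
      ∑ a ∈ Finset.range L, ∑ b ∈ Finset.range L, w a * K a b ≤ 18 * n := by
    intro w hw hwn
    calc _ ≤ ∑ a ∈ Finset.range L, w a * 2 := by
          refine Finset.sum_le_sum fun a _ => ?_
          rw [← Finset.mul_sum]
          exact mul_le_mul_of_nonneg_left (hKsum a) (hw a)
      _ ≤ _ := by rw [← Finset.sum_mul]; linarith
  have s1 := sum_le α hα0 hα
  have s2 := sum_le β hβ0 hβ
  rw [Finset.sum_comm] at s2
  have s3 : ∑ a ∈ Finset.range L, ∑ b ∈ Finset.range L, α a * β b ≤ (9 * n) * (9 * n) := by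
    rw [← Finset.sum_mul_sum]
    exact mul_le_mul hα hβ (Finset.sum_nonneg fun b _ => hβ0 b) (by positivity)
  calc _ ≤ ∑ a ∈ Finset.range L, ∑ b ∈ Finset.range L,
        (13824 * δ ^ 2 * (α a * K a b) + 13824 * δ ^ 2 * (β b * K b a) +
          768 * (p / δ ^ 2) * (α a * β b)) :=
        Finset.sum_le_sum fun a _ => Finset.sum_le_sum fun b _ => hpair a b
    _ = 13824 * δ ^ 2 * (∑ a ∈ Finset.range L, ∑ b ∈ Finset.range L, α a * K a b) +
          13824 * δ ^ 2 * (∑ a ∈ Finset.range L, ∑ b ∈ Finset.range L, β b * K b a) +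
          768 * (p / δ ^ 2) * (∑ a ∈ Finset.range L, ∑ b ∈ Finset.range L, α a * β b) := by
        simp_rw [Finset.sum_add_distrib, Finset.mul_sum]
    _ ≤ 13824 * δ ^ 2 * (18 * n) + 13824 * δ ^ 2 * (18 * n) +
          768 * (p / δ ^ 2) * ((9 * n) * (9 * n)) := by
        gcongr
    _ = 497664 * (n * δ ^ 2) + 62208 * (n * (n * p / δ ^ 2)) := by ring
    _ = _ := by rw [hd]; field_simp; ring

theorem exists_lattice_approx {n : ℕ} (hn : 0 < n) (x : EuclideanSpace ℝ (Fin n)) (hx : ‖x‖ = 1) :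
    ∃ u : Fin n → ℤ, ∑ i, (u i : ℝ) ^ 2 ≤ 9 * n ∧
      ‖x - WithLp.toLp 2 (fun i => (u i : ℝ) / (2 * √n))‖ ≤ 1 / 4 := by
  have hn' : (0 : ℝ) < n := by exact_mod_cast hn
  have hs : 0 < √(n : ℝ) := Real.sqrt_pos.2 hn'
  have hsq : √(n : ℝ) ^ 2 = n := Real.sq_sqrt hn'.le
  have hx2 : ∑ i, x i ^ 2 = 1 := by
    rw [← EuclideanSpace.real_norm_sq_eq, hx, one_pow]
  have hr : ∀ i, (2 * √n * x i - round (2 * √n * x i)) ^ 2 ≤ 1 / 4 := by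
    intro i
    have := abs_sub_round (2 * √n * x i)
    rw [← sq_abs]
    nlinarith [abs_nonneg (2 * √n * x i - round (2 * √n * x i))]
  refine ⟨fun i => round (2 * √n * x i), ?_, ?_⟩
  · calc ∑ i, ((round (2 * √n * x i) : ℤ) : ℝ) ^ 2 ≤ ∑ i, (8 * n * x i ^ 2 + 1 / 2) := by
          refine Finset.sum_le_sum fun i _ => ?_
          have h1 : 8 * n * x i ^ 2 = 2 * (2 * √n * x i) ^ 2 := by
            rw [mul_pow, mul_pow, hsq]; ring
          rw [h1]
          nlinarith [hr i, sq_nonneg (2 * (2 * √n * x i) - round (2 * √n * x i))]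
      _ = 8 * n + n * (1 / 2) := by
          rw [Finset.sum_add_distrib, ← Finset.mul_sum, hx2]; simp
      _ ≤ _ := by linarith
  · refine le_of_sq_le_sq ?_ (by norm_num)
    rw [EuclideanSpace.real_norm_sq_eq]
    calc _ ≤ ∑ i : Fin n, 1 / (16 * (n : ℝ)) := by
          refine Finset.sum_le_sum fun i _ => ?_
          have : (x - WithLp.toLp 2 fun i => ((round (2 * √n * x i) : ℤ) : ℝ) / (2 * √n)) i =
              (2 * √n * x i - round (2 * √n * x i)) / (2 * √n) := by
            simp only [PiLp.sub_apply]
            field_simp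
          rw [this, div_pow, mul_pow, hsq, div_le_div_iff₀ (by positivity) (by positivity)]
          nlinarith [hr i]
      _ = (1 / 4) ^ 2 := by
          simp only [Finset.sum_const, Finset.card_univ, Fintype.card_fin, nsmul_eq_mul]
          field_simp
          norm_num

theorem specNorm_le_of_lattice {n : ℕ} (hn : 0 < n) (W : Matrix (Fin n) (Fin n) ℝ) {M : ℝ}
    (hM : ∀ u v : Fin n → ℤ, ∑ i, (u i : ℝ) ^ 2 ≤ 9 * n → ∑ i, (v i : ℝ) ^ 2 ≤ 9 * n →
      ∑ i, ∑ j, W i j * (u i * v j) ≤ M) :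
    specNorm W ≤ M / n := by
  have hn' : (0 : ℝ) < n := by exact_mod_cast hn
  have hsq : √(n : ℝ) ^ 2 = n := Real.sq_sqrt hn'.le
  have hM0 : 0 ≤ M := by
    have := hM 0 0 (by simp) (by simp)
    simpa using this
  set T := Matrix.toEuclideanCLM (𝕜 := ℝ) W with hT
  have key : ‖T‖ ≤ M / (4 * n) + 9 / 16 * ‖T‖ := by
    refine ContinuousLinearMap.opNorm_le_of_re_inner_le (by positivity) fun x y hx hy => ?_
    obtain ⟨v, hv, hxv⟩ := exists_lattice_approx hn x hx
    obtain ⟨u, hu, hyu⟩ := exists_lattice_approx hn y hy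
    set z : EuclideanSpace ℝ (Fin n) := WithLp.toLp 2 (fun i => (v i : ℝ) / (2 * √n)) with hz
    set w : EuclideanSpace ℝ (Fin n) := WithLp.toLp 2 (fun i => (u i : ℝ) / (2 * √n)) with hw
    have hwn : ‖w‖ ≤ 5 / 4 := by
      calc ‖w‖ = ‖y - (y - w)‖ := by rw [sub_sub_cancel]
        _ ≤ ‖y‖ + ‖y - w‖ := norm_sub_le _ _
        _ ≤ _ := by linarith
    have hmain : inner ℝ (T z) w ≤ M / (4 * n) := by
      rw [real_inner_comm, hT, Matrix.inner_toEuclideanCLM]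
      calc w ⬝ᵥ W *ᵥ z = (∑ i, ∑ j, W i j * (u i * v j)) / (4 * n) := by
            simp only [dotProduct, Matrix.mulVec, Finset.sum_div, Finset.mul_sum, hz, hw]
            refine Finset.sum_congr rfl fun i _ => Finset.sum_congr rfl fun j _ => ?_
            rw [show 4 * (n : ℝ) = (2 * √n) * (2 * √n) by rw [← Real.sq_sqrt hn'.le]; ring_nf; simp]
            field_simp
        _ ≤ _ := by gcongr; exact hM u v hu hv
    have e : inner ℝ (T x) y = inner ℝ (T z) w + inner ℝ (T (x - z)) w + inner ℝ (T x) (y - w) := by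
      rw [map_sub, inner_sub_left, inner_sub_right]; ring
    have b1 : inner ℝ (T (x - z)) w ≤ (‖T‖ * (1 / 4)) * (5 / 4) :=
      (real_inner_le_norm _ _).trans (mul_le_mul ((T.le_opNorm _).trans (by gcongr)) hwn
        (norm_nonneg _) (by positivity))
    have b2 : inner ℝ (T x) (y - w) ≤ (‖T‖ * 1) * (1 / 4) :=
      (real_inner_le_norm _ _).trans (mul_le_mul ((T.le_opNorm _).trans (by rw [hx])) hyu
        (norm_nonneg _) (by positivity))
    change inner ℝ (T x) y ≤ _
    rw [e]
    linarith
  have h4 : M / (4 * n) = M / n / 4 := by rw [div_div, mul_comm]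
  have : 0 ≤ M / n := by positivity
  change ‖T‖ ≤ _
  rw [h4] at key
  linarith

theorem HasBoundedDiscrepancy.specNorm_sub_le {n : ℕ} (hn : 0 < n) {B Q : Fin n → Fin n → ℝ}
    {p C : ℝ} (h : HasBoundedDiscrepancy B p) (hp : 0 < p) (hQ0 : ∀ i j, 0 ≤ Q i j)
    (hQ : ∀ i j, Q i j ≤ p)
    (light : ∀ u v : Fin n → ℤ, ∑ i, (u i : ℝ) ^ 2 ≤ 9 * n → ∑ i, (v i : ℝ) ^ 2 ≤ 9 * n →
      ∑ i, ∑ j, (if |(u i * v j : ℝ)| ≤ √(n * p) then (B i j - Q i j) * (u i * v j : ℝ) else 0) ≤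
        C * (n * √(n * p))) :
    specNorm (Matrix.of fun i j => B i j - Q i j) ≤ (C + 559953) * √(n * p) := by
  have hn' : (0 : ℝ) < n := by exact_mod_cast hn
  have hd0 : 0 < n * p := by positivity
  obtain ⟨δ, hδ, hδ2⟩ : ∃ δ : ℝ, 0 < δ ∧ √(n * p) = δ ^ 2 :=
    ⟨√√(n * p), by positivity, (Real.sq_sqrt (by positivity)).symm⟩
  have hd : n * p = δ ^ 4 := by
    rw [← Real.sq_sqrt hd0.le, hδ2]; ring
  rw [hδ2] at light ⊢
  have hfin : ((C + 559953) * (n * δ ^ 2)) / n = (C + 559953) * δ ^ 2 := by field_simp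
  rw [← hfin]
  refine specNorm_le_of_lattice hn _ fun u v hu hv => ?_
  have h1 := light u v hu hv
  have h2 := h.heavy_sum_le hδ hp hd hu hv
  have h3 : ∑ i, ∑ j, p / δ ^ 2 * ((u i : ℝ) ^ 2 * (v j : ℝ) ^ 2) ≤ 81 * (n * δ ^ 2) := by
    simp_rw [← Finset.mul_sum, ← Finset.sum_mul]
    calc p / δ ^ 2 * ((∑ i, (u i : ℝ) ^ 2) * ∑ j, (v j : ℝ) ^ 2)
        ≤ p / δ ^ 2 * ((9 * n) * (9 * n)) := by gcongr
      _ = 81 * (n * (n * p / δ ^ 2)) := by ring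
      _ = _ := by rw [hd]; field_simp
  calc ∑ i, ∑ j, (Matrix.of fun i j => B i j - Q i j) i j * (u i * v j : ℝ)
      ≤ ∑ i, ∑ j, ((if |(u i * v j : ℝ)| ≤ δ ^ 2 then (B i j - Q i j) * (u i * v j : ℝ) else 0) +
        (if δ ^ 2 < |(u i * v j : ℝ)| then B i j * |(u i * v j : ℝ)| else 0) +
        p / δ ^ 2 * ((u i : ℝ) ^ 2 * (v j : ℝ) ^ 2)) := by
        refine Finset.sum_le_sum fun i _ => Finset.sum_le_sum fun j _ => ?_
        rw [Matrix.of_apply]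
        by_cases hc : |(u i * v j : ℝ)| ≤ δ ^ 2
        · rw [if_pos hc, if_neg (not_lt.2 hc)]
          have : 0 ≤ p / δ ^ 2 * ((u i : ℝ) ^ 2 * (v j : ℝ) ^ 2) := by positivity
          linarith
        · rw [if_neg hc, if_pos (not_le.1 hc), sub_mul, zero_add]
          have e1 : B i j * (u i * v j : ℝ) ≤ B i j * |(u i * v j : ℝ)| :=
            mul_le_mul_of_nonneg_left (le_abs_self _) (h.nonneg i j)
          have e2 : -(Q i j * (u i * v j : ℝ)) ≤ p / δ ^ 2 * ((u i : ℝ) ^ 2 * (v j : ℝ) ^ 2) := by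
            rw [← mul_pow, ← sq_abs (u i * v j : ℝ), ← mul_neg]
            set r := |(u i * v j : ℝ)|
            calc Q i j * -(u i * v j : ℝ) ≤ p * r :=
                  (mul_le_mul_of_nonneg_left (neg_le_abs _) (hQ0 i j)).trans
                        (mul_le_mul_of_nonneg_right (hQ i j) (abs_nonneg _))
              _ = p / δ ^ 2 * (δ ^ 2 * r) := by field_simp
              _ ≤ p / δ ^ 2 * (r * r) := by
                  have := not_le.1 hc
                  gcongr
              _ = _ := by rw [sq r]
          linarith
    _ ≤ C * (n * δ ^ 2) + 559872 * (n * δ ^ 2) + 81 * (n * δ ^ 2) := by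
        simp_rw [Finset.sum_add_distrib]
        linarith
    _ = _ := by ring

instance (p : ℝ) : IsFiniteMeasure (bern p) := by
  have := (Measure.dirac false).smul_finite (ENNReal.ofReal_ne_top (r := 1 - p))
  have := (Measure.dirac true).smul_finite (ENNReal.ofReal_ne_top (r := p))
  unfold bern
  infer_instance

theorem isProbabilityMeasure_bern {p : ℝ} (h0 : 0 ≤ p) (h1 : p ≤ 1) :
    IsProbabilityMeasure (bern p) := by
  constructor
  simp only [bern, Measure.coe_add, Measure.coe_smul, Pi.add_apply, Pi.smul_apply, measure_univ,
    smul_eq_mul, mul_one]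
  rw [← ENNReal.ofReal_add (by linarith) h0]
  simp

theorem integral_bern {p : ℝ} (h0 : 0 ≤ p) (h1 : p ≤ 1) (f : Bool → ℝ) :
    ∫ b, f b ∂bern p = (1 - p) * f false + p * f true := by
  have := (Measure.dirac false).smul_finite (ENNReal.ofReal_ne_top (r := 1 - p))
  have := (Measure.dirac true).smul_finite (ENNReal.ofReal_ne_top (r := p))
  rw [bern, integral_add_measure .of_finite .of_finite, integral_smul_measure,
    integral_smul_measure, integral_dirac, integral_dirac, ENNReal.toReal_ofReal (by linarith),
    ENNReal.toReal_ofReal h0, smul_eq_mul, smul_eq_mul]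

/-- Independent Bernoulli variables with success probabilities `P i j`. -/
noncomputable def edgeMeasure {n : ℕ} (P : Fin n → Fin n → ℝ) : Measure (Fin n → Fin n → Bool) :=
  Measure.pi fun i => Measure.pi fun j => bern (P i j)

instance {n : ℕ} (P : Fin n → Fin n → ℝ) : IsFiniteMeasure (edgeMeasure P) := by
  unfold edgeMeasure; infer_instance

/-- The strictly upper triangular part of an array. -/
def strictUpper {n : ℕ} (c : Fin n → Fin n → ℝ) (i j : Fin n) : ℝ := if i < j then c i j else 0

/-- The strictly upper triangular 0/1 array of edge indicators. -/
def upperEdges {n : ℕ} (ω : Fin n → Fin n → Bool) : Fin n → Fin n → ℝ :=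
  strictUpper fun i j => if ω i j then 1 else 0

theorem measureReal_lt_sum_le {n : ℕ} {P : Fin n → Fin n → ℝ} (h0 : ∀ i j, 0 ≤ P i j)
    (h1 : ∀ i j, P i j ≤ 1) (c : Fin n → Fin n → ℝ) (r : ℝ) :
    (edgeMeasure P).real {ω | r < ∑ i, ∑ j, c i j * upperEdges ω i j} ≤
      Real.exp (∑ i, ∑ j, strictUpper P i j * (Real.exp (c i j) - 1) - r) := by
  have hmgf : mgf (fun ω => ∑ i, ∑ j, c i j * upperEdges ω i j) (edgeMeasure P) 1 ≤
      Real.exp (∑ i, ∑ j, strictUpper P i j * (Real.exp (c i j) - 1)) := by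
    have e1 : ∀ ω : Fin n → Fin n → Bool,
        Real.exp (1 * ∑ i, ∑ j, c i j * upperEdges ω i j) =
        ∏ i, ∏ j, Real.exp (strictUpper c i j * if ω i j then 1 else 0) := by
      intro ω
      rw [one_mul, Real.exp_sum]
      refine Finset.prod_congr rfl fun i _ => ?_
      rw [Real.exp_sum]
      refine Finset.prod_congr rfl fun j _ => ?_
      cases h : ω i j <;> by_cases hij : i < j <;> simp [upperEdges, strictUpper, h, hij]
    unfold mgf
    simp_rw [e1]
    rw [edgeMeasure, integral_fintype_prod_eq_prod
      (f := fun i (w : Fin n → Bool) =>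
        ∏ j, Real.exp (strictUpper c i j * if w j then 1 else 0)), Real.exp_sum]
    refine Finset.prod_le_prod (fun i _ => integral_nonneg fun w =>
      Finset.prod_nonneg fun j _ => (Real.exp_pos _).le) fun i _ => ?_
    rw [integral_fintype_prod_eq_prod
      (f := fun j (b : Bool) => Real.exp (strictUpper c i j * if b then 1 else 0)), Real.exp_sum]
    refine Finset.prod_le_prod (fun j _ => integral_nonneg fun b => (Real.exp_pos _).le)
      fun j _ => ?_
    rw [integral_bern (h0 i j) (h1 i j)]
    simp only [Bool.false_eq_true, if_false, if_true, mul_zero, mul_one, Real.exp_zero]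
    by_cases hij : i < j
    · have := Real.add_one_le_exp (P i j * (Real.exp (c i j) - 1))
      simp only [strictUpper, hij, if_true]
      linarith
    · simp [strictUpper, hij]
  calc (edgeMeasure P).real {ω | r < ∑ i, ∑ j, c i j * upperEdges ω i j}
      ≤ (edgeMeasure P).real {ω | r ≤ ∑ i, ∑ j, c i j * upperEdges ω i j} :=
        measureReal_mono fun ω hω => by
          rw [Set.mem_ofPred_eq] at hω ⊢
          exact hω.le
    _ ≤ Real.exp (-1 * r) * mgf (fun ω => ∑ i, ∑ j, c i j * upperEdges ω i j) (edgeMeasure P) 1 :=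
        measure_ge_le_exp_mul_mgf r zero_le_one .of_finite
    _ ≤ Real.exp (-1 * r) * Real.exp (∑ i, ∑ j, strictUpper P i j * (Real.exp (c i j) - 1)) := by
        gcongr
    _ = Real.exp (∑ i, ∑ j, strictUpper P i j * (Real.exp (c i j) - 1) - r) := by
        rw [← Real.exp_add]; congr 1; ring

theorem strictUpper_nonneg {n : ℕ} {P : Fin n → Fin n → ℝ} (h0 : ∀ i j, 0 ≤ P i j) (i j : Fin n) :
    0 ≤ strictUpper P i j := by
  unfold strictUpper; split_ifs <;> simp [h0]

theorem strictUpper_le {n : ℕ} {P : Fin n → Fin n → ℝ} {p : ℝ} (hp0 : 0 ≤ p)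
    (hp : ∀ i j, P i j ≤ p) (i j : Fin n) : strictUpper P i j ≤ p := by
  unfold strictUpper; split_ifs <;> simp [hp, hp0]

theorem sum_ite_mem_product {n : ℕ} (S T : Finset (Fin n)) (f : Fin n → Fin n → ℝ) :
    ∑ i, ∑ j, (if i ∈ S ∧ j ∈ T then f i j else 0) = ∑ i ∈ S, ∑ j ∈ T, f i j := by
  calc _ = ∑ i, if i ∈ S then ∑ j ∈ T, f i j else 0 :=
        Finset.sum_congr rfl fun i _ => by split_ifs with h <;> simp [h]
    _ = _ := by rw [Finset.sum_ite_mem, Finset.univ_inter]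

theorem measureReal_lt_edges_le {n : ℕ} {P : Fin n → Fin n → ℝ} {p : ℝ} (h0 : ∀ i j, 0 ≤ P i j)
    (hp : ∀ i j, P i j ≤ p) (hp0 : 0 ≤ p) (hp1 : p ≤ 1) (S T : Finset (Fin n)) {θ : ℝ}
    (hθ : 0 ≤ θ) (r : ℝ) :
    (edgeMeasure P).real {ω | r < θ * ∑ i ∈ S, ∑ j ∈ T, upperEdges ω i j} ≤
      Real.exp (p * S.card * T.card * Real.exp θ - r) := by
  have h := measureReal_lt_sum_le h0 (fun i j => (hp i j).trans hp1)
    (fun i j => if i ∈ S ∧ j ∈ T then θ else 0) r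
  have e1 : ∀ ω : Fin n → Fin n → Bool,
      ∑ i, ∑ j, (if i ∈ S ∧ j ∈ T then θ else 0) * upperEdges ω i j =
      θ * ∑ i ∈ S, ∑ j ∈ T, upperEdges ω i j := by
    intro ω
    simp_rw [ite_mul, zero_mul]
    rw [sum_ite_mem_product S T (fun i j => θ * upperEdges ω i j)]
    simp_rw [Finset.mul_sum]
  simp_rw [e1] at h
  refine h.trans (Real.exp_le_exp.2 (sub_le_sub_right ?_ _))
  calc ∑ i, ∑ j, strictUpper P i j * (Real.exp (if i ∈ S ∧ j ∈ T then θ else 0) - 1)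
      ≤ ∑ i, ∑ j, (if i ∈ S ∧ j ∈ T then p * Real.exp θ else 0) := by
        refine Finset.sum_le_sum fun i _ => Finset.sum_le_sum fun j _ => ?_
        have := strictUpper_le hp0 hp i j
        have := strictUpper_nonneg h0 i j
        split_ifs
        · have := Real.one_le_exp hθ
          exact mul_le_mul ‹_› (by linarith) (by linarith) hp0
        · simp
    _ = _ := by
        rw [sum_ite_mem_product S T (fun _ _ => p * Real.exp θ)]
        simp only [Finset.sum_const, nsmul_eq_mul]
        ring

theorem measureReal_lt_light_sum_le {n : ℕ} {P : Fin n → Fin n → ℝ} {p : ℝ}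
    (h0 : ∀ i j, 0 ≤ P i j) (hp : ∀ i j, P i j ≤ p) (hp0 : 0 < p) (hp1 : p ≤ 1) (hn : 0 < n)
    {u v : Fin n → ℤ} (hu : ∑ i, (u i : ℝ) ^ 2 ≤ 9 * n) (hv : ∑ i, (v i : ℝ) ^ 2 ≤ 9 * n) :
    (edgeMeasure P).real {ω | 104 * (n * √(n * p)) <
      ∑ i, ∑ j, (if |(u i * v j : ℝ)| ≤ √(n * p) then
        (upperEdges ω i j - strictUpper P i j) * (u i * v j : ℝ) else 0)} ≤
      Real.exp (-(23 * n)) := by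
  have hn' : (0 : ℝ) < n := by exact_mod_cast hn
  have hs : 0 < √(n * p) := Real.sqrt_pos.2 (by positivity)
  have hsq : √(n * p) ^ 2 = n * p := Real.sq_sqrt (by positivity)
  set c : Fin n → Fin n → ℝ := fun i j =>
    if |(u i * v j : ℝ)| ≤ √(n * p) then (u i * v j : ℝ) / √(n * p) else 0 with hc
  have hc1 : ∀ i j, |c i j| ≤ 1 := by
    intro i j
    simp only [hc]
    split_ifs with h
    · rw [abs_div, abs_of_pos hs, div_le_one hs]; exact h
    · simp
  have hc2 : ∀ i j, c i j ^ 2 ≤ (u i : ℝ) ^ 2 * (v j : ℝ) ^ 2 / (n * p) := by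
    intro i j
    simp only [hc]
    split_ifs with h
    · rw [div_pow, mul_pow, hsq]
    · rw [zero_pow two_ne_zero]; positivity
  have h := measureReal_lt_sum_le h0 (fun i j => (hp i j).trans hp1) c
    (104 * n + ∑ i, ∑ j, c i j * strictUpper P i j)
  have hset : {ω | 104 * (n * √(n * p)) <
      ∑ i, ∑ j, (if |(u i * v j : ℝ)| ≤ √(n * p) then
        (upperEdges ω i j - strictUpper P i j) * (u i * v j : ℝ) else 0)} =
      {ω | 104 * n + ∑ i, ∑ j, c i j * strictUpper P i j <
        ∑ i, ∑ j, c i j * upperEdges ω i j} := by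
    ext ω
    have : ∑ i, ∑ j, (if |(u i * v j : ℝ)| ≤ √(n * p) then
        (upperEdges ω i j - strictUpper P i j) * (u i * v j : ℝ) else 0) =
        √(n * p) * (∑ i, ∑ j, c i j * upperEdges ω i j - ∑ i, ∑ j, c i j * strictUpper P i j) := by
      simp_rw [← Finset.sum_sub_distrib, Finset.mul_sum]
      refine Finset.sum_congr rfl fun i _ => Finset.sum_congr rfl fun j _ => ?_
      simp only [hc]
      split_ifs
      · field_simp
      · ring
    rw [Set.mem_ofPred_eq, Set.mem_ofPred_eq, this,
      show 104 * ((n : ℝ) * √(n * p)) = √(n * p) * (104 * n) by ring, mul_lt_mul_iff_right₀ hs,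
      lt_sub_iff_add_lt]
  rw [hset]
  refine h.trans (Real.exp_le_exp.2 ?_)
  have hsum : ∑ i, ∑ j, strictUpper P i j * (Real.exp (c i j) - 1) ≤
      ∑ i, ∑ j, c i j * strictUpper P i j + 81 * n := by
    calc _ ≤ ∑ i, ∑ j, (c i j * strictUpper P i j +
          p * ((u i : ℝ) ^ 2 * (v j : ℝ) ^ 2 / (n * p))) := by
          refine Finset.sum_le_sum fun i _ => Finset.sum_le_sum fun j _ => ?_
          have e1 := (abs_le.1 (Real.abs_exp_sub_one_sub_id_le (hc1 i j))).2
          have e2 := strictUpper_le hp0.le hp i j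
          have e3 := strictUpper_nonneg h0 i j
          have e4 : strictUpper P i j * (Real.exp (c i j) - 1 - c i j) ≤
              p * ((u i : ℝ) ^ 2 * (v j : ℝ) ^ 2 / (n * p)) :=
            (mul_le_mul_of_nonneg_left (e1.trans (hc2 i j)) e3).trans
              (mul_le_mul_of_nonneg_right e2 (by positivity))
          linarith
      _ = ∑ i, ∑ j, c i j * strictUpper P i j +
          (∑ i, (u i : ℝ) ^ 2) * (∑ j, (v j : ℝ) ^ 2) / n := by
          simp_rw [Finset.sum_add_distrib]
          congr 1
          rw [Finset.sum_mul_sum, Finset.sum_div]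
          refine Finset.sum_congr rfl fun i _ => ?_
          rw [Finset.sum_div]
          refine Finset.sum_congr rfl fun j _ => ?_
          field_simp
      _ ≤ ∑ i, ∑ j, c i j * strictUpper P i j + (9 * n) * (9 * n) / n := by gcongr
      _ = _ := by field_simp; ring
  linarith

/-- The exponent `m (1 + log (n / m))` bounding the logarithm of `n.choose m`. -/
noncomputable def chooseExponent (n m : ℕ) : ℝ := m * (1 + Real.log (n / m))

theorem chooseExponent_mono {n s t : ℕ} (ht : 0 < t) (hts : t ≤ s) (hsn : s ≤ n) :
    chooseExponent n t ≤ chooseExponent n s := by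
  have ht' : (0 : ℝ) < t := by exact_mod_cast ht
  have hts' : (t : ℝ) ≤ s := by exact_mod_cast hts
  have hsn' : (s : ℝ) ≤ n := by exact_mod_cast hsn
  have hs' : (0 : ℝ) < s := ht'.trans_le hts'
  have hn' : (0 : ℝ) < n := hs'.trans_le hsn'
  have e1 : Real.log (n / t) = Real.log (n / s) + Real.log (s / t) := by
    rw [← Real.log_mul (by positivity) (by positivity)]
    congr 1
    field_simp
  have e2 : t * Real.log (s / t) ≤ s - t := by
    have := mul_le_mul_of_nonneg_left (Real.log_le_sub_one_of_pos (div_pos hs' ht')) ht'.le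
    have e : (t : ℝ) * (s / t - 1) = s - t := by field_simp
    linarith
  have e3 : 0 ≤ Real.log (n / s : ℝ) := Real.log_nonneg ((one_le_div hs').2 hsn')
  have e4 := mul_le_mul_of_nonneg_right hts' e3
  unfold chooseExponent
  rw [e1]
  linarith

theorem choose_le_exp_chooseExponent {n m : ℕ} (hm : 0 < m) (hmn : m ≤ n) :
    (n.choose m : ℝ) ≤ Real.exp (chooseExponent n m) := by
  have hm' : (0 : ℝ) < m := by exact_mod_cast hm
  have hn' : (0 : ℝ) < n := hm'.trans_le (by exact_mod_cast hmn)
  calc (n.choose m : ℝ) ≤ n ^ m / m.factorial := Nat.choose_le_pow_div m n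
    _ = (n / m) ^ m * (m ^ m / m.factorial) := by rw [div_pow]; field_simp
    _ ≤ (n / m) ^ m * Real.exp m := by
        gcongr
        exact Real.pow_div_factorial_le_exp _ hm'.le m
    _ = Real.exp (chooseExponent n m) := by
        rw [chooseExponent, mul_add, mul_one, Real.exp_add, mul_comm (m : ℝ) (Real.log _),
          Real.exp_mul, Real.exp_log (by positivity), Real.rpow_natCast, mul_comm]

theorem sum_exp_neg_chooseExponent_le {n : ℕ} (hn : 0 < n) :
    ∑ S : Finset (Fin n) with S.Nonempty, Real.exp (-(3 * chooseExponent n S.card)) ≤ 1 / n := by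
  have hn' : (0 : ℝ) < n := by exact_mod_cast hn
  have h := Finset.sum_powerset_apply_card
    (fun m => if m = 0 then 0 else Real.exp (-(3 * chooseExponent n m)))
    (x := (Finset.univ : Finset (Fin n)))
  rw [Finset.powerset_univ, Finset.card_univ, Fintype.card_fin] at h
  calc _ = ∑ S : Finset (Fin n), if S.card = 0 then 0 else
          Real.exp (-(3 * chooseExponent n S.card)) := by
        rw [Finset.sum_filter]
        refine Finset.sum_congr rfl fun S _ => ?_
        by_cases hS : S = ∅ <;> simp [hS, Finset.nonempty_iff_ne_empty]
    _ = _ := h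
    _ ≤ ∑ m ∈ Finset.range n, 1 / (n : ℝ) ^ 2 := by
        rw [Finset.sum_range_succ']
        simp only [if_true, smul_zero, add_zero, Nat.add_eq_zero_iff, one_ne_zero, and_false,
          if_false]
        refine Finset.sum_le_sum fun m hm => ?_
        have hmn : m + 1 ≤ n := Finset.mem_range.1 hm
        have e1 := choose_le_exp_chooseExponent m.succ_pos hmn
        have e2 := chooseExponent_mono one_pos (Nat.le_add_left 1 m) hmn
        have e3 : Real.log n ≤ chooseExponent n 1 := by simp [chooseExponent]
        rw [nsmul_eq_mul]
        calc _ ≤ Real.exp (chooseExponent n (m + 1)) *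
              Real.exp (-(3 * chooseExponent n (m + 1))) := by gcongr
          _ ≤ Real.exp (-(2 * Real.log n)) := by
              rw [← Real.exp_add, Real.exp_le_exp]
              linarith
          _ = 1 / (n : ℝ) ^ 2 := by
              rw [Real.exp_neg, two_mul, Real.exp_add, Real.exp_log hn', one_div, sq]
    _ = 1 / n := by
        rw [Finset.sum_const, Finset.card_range, nsmul_eq_mul]
        field_simp

/-- The integer points of the Euclidean ball of radius `3 √n`. -/
noncomputable def latticeBall (n : ℕ) : Finset (Fin n → ℤ) :=
  {u ∈ Fintype.piFinset fun _ => Finset.Icc (-(9 * n : ℤ)) (9 * n) | ∑ i, u i ^ 2 ≤ 9 * n}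

theorem mem_latticeBall {n : ℕ} {u : Fin n → ℤ} (hu : ∑ i, (u i : ℝ) ^ 2 ≤ 9 * n) :
    u ∈ latticeBall n := by
  have hu' : ∑ i, u i ^ 2 ≤ 9 * (n : ℤ) := by exact_mod_cast hu
  refine Finset.mem_filter.2 ⟨Fintype.mem_piFinset.2 fun i => ?_, hu'⟩
  have h1 := Finset.single_le_sum (f := fun i => u i ^ 2) (fun i _ => sq_nonneg _)
    (Finset.mem_univ i)
  have h2 := Int.le_self_sq (u i)
  have h3 := Int.le_self_sq (-u i)
  rw [neg_sq] at h3
  exact Finset.mem_Icc.2 ⟨by linarith, by linarith⟩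

theorem sum_half_pow_natAbs_le (N : ℕ) :
    ∑ z ∈ Finset.Icc (-(N : ℤ)) N, (1 / 2 : ℝ) ^ z.natAbs = 3 - 2 * (1 / 2) ^ N := by
  induction N with
  | zero => norm_num
  | succ N ih =>
    have e : Finset.Icc (-((N + 1 : ℕ) : ℤ)) (N + 1 : ℕ) =
        insert (-((N + 1 : ℕ) : ℤ)) (insert ((N + 1 : ℕ) : ℤ) (Finset.Icc (-(N : ℤ)) N)) := by
      ext z
      simp only [Finset.mem_insert, Finset.mem_Icc]
      omega
    rw [e, Finset.sum_insert, Finset.sum_insert, ih, Int.natAbs_neg, Int.natAbs_natCast, pow_succ]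
    · ring
    · simp only [Finset.mem_Icc]; omega
    · simp only [Finset.mem_insert, Finset.mem_Icc]; omega

theorem card_latticeBall_le (n : ℕ) : ((latticeBall n).card : ℝ) ≤ Real.exp (11 * n) := by
  have h1 : (latticeBall n).card * (1 / 2 : ℝ) ^ (9 * n) ≤ 3 ^ n := by
    calc _ = ∑ u ∈ latticeBall n, (1 / 2 : ℝ) ^ (9 * n) := by simp
      _ ≤ ∑ u ∈ latticeBall n, ∏ i, (1 / 2 : ℝ) ^ (u i).natAbs := by
          refine Finset.sum_le_sum fun u hu => ?_
          rw [Finset.prod_pow_eq_pow_sum]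
          refine pow_le_pow_of_le_one (by norm_num) (by norm_num) ?_
          have : ∑ i, u i ^ 2 ≤ 9 * (n : ℤ) := (Finset.mem_filter.1 hu).2
          zify
          refine (Finset.sum_le_sum fun i _ => ?_).trans this
          rw [← sq_abs]
          exact Int.le_self_sq _
      _ ≤ ∑ u ∈ Fintype.piFinset fun _ : Fin n => Finset.Icc (-(9 * n : ℤ)) (9 * n),
            ∏ i, (1 / 2 : ℝ) ^ (u i).natAbs :=
          Finset.sum_le_sum_of_subset_of_nonneg (Finset.filter_subset _ _)
            fun u _ _ => Finset.prod_nonneg fun i _ => by positivity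
      _ = (∑ z ∈ Finset.Icc (-((9 * n : ℕ) : ℤ)) (9 * n : ℕ), (1 / 2 : ℝ) ^ z.natAbs) ^ n := by
          have := Finset.prod_univ_sum (fun _ : Fin n => Finset.Icc (-(9 * n : ℤ)) (9 * n))
            fun _ z => (1 / 2 : ℝ) ^ z.natAbs
          rw [← this]
          simp
      _ ≤ 3 ^ n := by
          rw [sum_half_pow_natAbs_le]
          have e1 : (1 / 2 : ℝ) ^ (9 * n) ≤ 1 := pow_le_one₀ (by norm_num) (by norm_num)
          have e2 : (0 : ℝ) < (1 / 2 : ℝ) ^ (9 * n) := by positivity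
          exact pow_le_pow_left₀ (by linarith) (by linarith) n
  have h2 : (2 : ℝ) ≤ Real.exp 1 := by linarith [Real.add_one_le_exp (1 : ℝ)]
  calc ((latticeBall n).card : ℝ) =
        (latticeBall n).card * (1 / 2 : ℝ) ^ (9 * n) * 2 ^ (9 * n) := by
        rw [mul_assoc, ← mul_pow]; norm_num
    _ ≤ 3 ^ n * 2 ^ (9 * n) := by gcongr
    _ = (3 * 2 ^ 9) ^ n := by rw [mul_pow, pow_mul]
    _ ≤ (2 ^ 11) ^ n := pow_le_pow_left₀ (by norm_num) (by norm_num) n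
    _ ≤ (Real.exp 1 ^ 11) ^ n := by gcongr
    _ = Real.exp (11 * n) := by
        rw [← pow_mul, ← Real.exp_nat_mul, mul_one]; push_cast; rfl

theorem measureReal_exists_pair_le {n : ℕ} {P : Fin n → Fin n → ℝ} {p : ℝ} (h0 : ∀ i j, 0 ≤ P i j)
    (hp : ∀ i j, P i j ≤ p) (hp0 : 0 ≤ p) (hp1 : p ≤ 1) (hn : 0 < n) {θ : ℕ → ℝ}
    (hθ : ∀ m, 0 < m → m ≤ n → 0 ≤ θ m) :
    (edgeMeasure P).real {ω | ∃ S T : Finset (Fin n), S.Nonempty ∧ T.Nonempty ∧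
      p * S.card * T.card * Real.exp (θ (max S.card T.card)) +
        6 * chooseExponent n (max S.card T.card) <
      θ (max S.card T.card) * ∑ i ∈ S, ∑ j ∈ T, upperEdges ω i j} ≤ 1 / n * (1 / n) := by
  let s : Finset (Finset (Fin n)) := {S | S.Nonempty}
  let E : Finset (Fin n) → Finset (Fin n) → Set (Fin n → Fin n → Bool) := fun S T =>
    {ω | p * S.card * T.card * Real.exp (θ (max S.card T.card)) +
        6 * chooseExponent n (max S.card T.card) <
      θ (max S.card T.card) * ∑ i ∈ S, ∑ j ∈ T, upperEdges ω i j}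
  have hE : ∀ S ∈ s, ∀ T ∈ s, (edgeMeasure P).real (E S T) ≤
      Real.exp (-(3 * chooseExponent n S.card)) * Real.exp (-(3 * chooseExponent n T.card)) := by
    intro S hS T hT
    have hS' : 0 < S.card := Finset.card_pos.2 (Finset.mem_filter.1 hS).2
    have hT' : 0 < T.card := Finset.card_pos.2 (Finset.mem_filter.1 hT).2
    have hSn : S.card ≤ n := by simpa using S.card_le_univ
    have hTn : T.card ≤ n := by simpa using T.card_le_univ
    have hm : max S.card T.card ≤ n := max_le hSn hTn
    refine (measureReal_lt_edges_le h0 hp hp0 hp1 S T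
      (hθ _ (lt_max_of_lt_left hS') hm) _).trans ?_
    rw [← Real.exp_add, Real.exp_le_exp]
    have e1 := chooseExponent_mono hS' (le_max_left S.card T.card) hm
    have e2 := chooseExponent_mono hT' (le_max_right S.card T.card) hm
    linarith
  calc _ ≤ (edgeMeasure P).real (⋃ S ∈ s, ⋃ T ∈ s, E S T) := by
        refine measureReal_mono ?_ (measure_ne_top _ _)
        rintro ω ⟨S, T, hS, hT, h⟩
        simp only [Set.mem_iUnion]
        exact ⟨S, by simpa [s] using hS, T, by simpa [s] using hT, h⟩
    _ ≤ ∑ S ∈ s, ∑ T ∈ s, (edgeMeasure P).real (E S T) :=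
        (measureReal_biUnion_finset_le _ _).trans
          (Finset.sum_le_sum fun S _ => measureReal_biUnion_finset_le _ _)
    _ ≤ ∑ S ∈ s, ∑ T ∈ s, Real.exp (-(3 * chooseExponent n S.card)) *
          Real.exp (-(3 * chooseExponent n T.card)) :=
        Finset.sum_le_sum fun S hS => Finset.sum_le_sum fun T hT => hE S hS T hT
    _ = (∑ S ∈ s, Real.exp (-(3 * chooseExponent n S.card))) *
          ∑ S ∈ s, Real.exp (-(3 * chooseExponent n S.card)) := (Finset.sum_mul_sum ..).symm
    _ ≤ 1 / n * (1 / n) :=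
        mul_le_mul (sum_exp_neg_chooseExponent_le hn) (sum_exp_neg_chooseExponent_le hn)
          (Finset.sum_nonneg fun S _ => (Real.exp_pos _).le) (by positivity)

theorem measureReal_exists_edges_le {n : ℕ} {P : Fin n → Fin n → ℝ} {p : ℝ}
    (h0 : ∀ i j, 0 ≤ P i j) (hp : ∀ i j, P i j ≤ p) (hp0 : 0 ≤ p) (hp1 : p ≤ 1) (hn : 0 < n)
    (hnp : 3 * Real.log n ≤ n * p) {S T : Fin n → Finset (Fin n)}
    (hST : ∀ k, ((S k).card * (T k).card : ℝ) = n) :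
    (edgeMeasure P).real {ω | ∃ k, 4 * (n * p) < ∑ i ∈ S k, ∑ j ∈ T k, upperEdges ω i j} ≤
      1 / n * (1 / n) := by
  have hn' : (0 : ℝ) < n := by exact_mod_cast hn
  rw [Set.ofPred_exists]
  refine (measureReal_iUnion_fintype_le _).trans ?_
  calc _ ≤ ∑ k : Fin n, Real.exp (-(3 * Real.log n)) := by
        refine Finset.sum_le_sum fun k _ => ?_
        have h := measureReal_lt_edges_le h0 hp hp0 hp1 (S k) (T k) zero_le_one (4 * (n * p))
        simp_rw [one_mul] at h
        refine h.trans (Real.exp_le_exp.2 ?_)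
        rw [mul_assoc p, hST]
        have := mul_le_mul_of_nonneg_left Real.exp_one_lt_three.le (mul_nonneg hp0 hn'.le)
        linarith
    _ = 1 / n * (1 / n) := by
        rw [Finset.sum_const, Finset.card_univ, Fintype.card_fin, nsmul_eq_mul, Real.exp_neg,
          show 3 * Real.log n = ((3 : ℕ) : ℝ) * Real.log n by norm_num, Real.exp_nat_mul,
          Real.exp_log hn']
        field_simp

theorem measureReal_exists_light_sum_le {n : ℕ} {P : Fin n → Fin n → ℝ} {p : ℝ}
    (h0 : ∀ i j, 0 ≤ P i j) (hp : ∀ i j, P i j ≤ p) (hp0 : 0 < p) (hp1 : p ≤ 1) (hn : 0 < n) :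
    (edgeMeasure P).real {ω | ∃ u v : Fin n → ℤ, ∑ i, (u i : ℝ) ^ 2 ≤ 9 * n ∧
      ∑ i, (v i : ℝ) ^ 2 ≤ 9 * n ∧ 104 * (n * √(n * p)) <
      ∑ i, ∑ j, (if |(u i * v j : ℝ)| ≤ √(n * p) then
        (upperEdges ω i j - strictUpper P i j) * (u i * v j : ℝ) else 0)} ≤ Real.exp (-n) := by
  let E : (Fin n → ℤ) → (Fin n → ℤ) → Set (Fin n → Fin n → Bool) := fun u v =>
    {ω | 104 * (n * √(n * p)) < ∑ i, ∑ j, (if |(u i * v j : ℝ)| ≤ √(n * p) then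
        (upperEdges ω i j - strictUpper P i j) * (u i * v j : ℝ) else 0)}
  have hb : ∀ u ∈ latticeBall n, ∑ i, (u i : ℝ) ^ 2 ≤ 9 * n := fun u hu => by
    exact_mod_cast (Finset.mem_filter.1 hu).2
  calc _ ≤ (edgeMeasure P).real (⋃ u ∈ latticeBall n, ⋃ v ∈ latticeBall n, E u v) := by
        refine measureReal_mono ?_ (measure_ne_top _ _)
        rintro ω ⟨u, v, hu, hv, h⟩
        simp only [Set.mem_iUnion]
        exact ⟨u, mem_latticeBall hu, v, mem_latticeBall hv, h⟩
    _ ≤ ∑ u ∈ latticeBall n, ∑ v ∈ latticeBall n, (edgeMeasure P).real (E u v) :=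
        (measureReal_biUnion_finset_le _ _).trans
          (Finset.sum_le_sum fun u _ => measureReal_biUnion_finset_le _ _)
    _ ≤ ∑ u ∈ latticeBall n, ∑ v ∈ latticeBall n, Real.exp (-(23 * n)) :=
        Finset.sum_le_sum fun u hu => Finset.sum_le_sum fun v hv =>
          measureReal_lt_light_sum_le h0 hp hp0 hp1 hn (hb u hu) (hb v hv)
    _ = (latticeBall n).card * ((latticeBall n).card * Real.exp (-(23 * n))) := by
        simp only [Finset.sum_const, nsmul_eq_mul]
    _ ≤ Real.exp (11 * n) * (Real.exp (11 * n) * Real.exp (-(23 * n))) := by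
        have := card_latticeBall_le n
        gcongr
    _ = Real.exp (-n) := by
        rw [← Real.exp_add, ← Real.exp_add]
        congr 1
        ring

theorem hasBoundedDiscrepancy_upperEdges {n : ℕ} {p : ℝ} {ω : Fin n → Fin n → Bool}
    (hrow : ∀ k, ∑ i ∈ {k}, ∑ j, upperEdges ω i j ≤ 4 * (n * p))
    (hcol : ∀ k, ∑ i, ∑ j ∈ {k}, upperEdges ω i j ≤ 4 * (n * p))
    (hp0 : 0 ≤ p)
    (hlin : ∀ S T : Finset (Fin n), S.Nonempty → T.Nonempty →
      1 * ∑ i ∈ S, ∑ j ∈ T, upperEdges ω i j ≤ p * S.card * T.card * Real.exp 1 +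
        6 * chooseExponent n (max S.card T.card))
    (hpois : ∀ S T : Finset (Fin n), S.Nonempty → T.Nonempty →
      (1 + Real.log (n / (max S.card T.card : ℕ))) / 2 * ∑ i ∈ S, ∑ j ∈ T, upperEdges ω i j ≤
        p * S.card * T.card * Real.exp ((1 + Real.log (n / (max S.card T.card : ℕ))) / 2) +
        6 * chooseExponent n (max S.card T.card)) :
    HasBoundedDiscrepancy (upperEdges ω) p where
  nonneg i j := strictUpper_nonneg (fun i j => by split_ifs <;> norm_num) i j
  row_sum i := by simpa using hrow i
  col_sum j := by simpa using hcol j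
  linear S T hS hT m hm := by
    subst hm
    have h1 := hlin S T hS hT
    have h2 : p * S.card * T.card * Real.exp 1 ≤ p * S.card * T.card * 3 := by
      have := Real.exp_one_lt_three.le
      gcongr
    rw [chooseExponent] at h1
    linarith
  poisson S T hS hT m hm := by
    subst hm
    have h1 := hpois S T hS hT
    rw [chooseExponent] at h1
    linarith

theorem measureReal_lt_specNorm_le {n : ℕ} {P : Fin n → Fin n → ℝ} {p : ℝ}
    (h0 : ∀ i j, 0 ≤ P i j) (hp : ∀ i j, P i j ≤ p) (hp0 : 0 < p) (hp1 : p ≤ 1) (hn : 6 ≤ n)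
    (hnp : 3 * Real.log n ≤ n * p) :
    (edgeMeasure P).real {ω | 560057 * √(n * p) <
      specNorm (Matrix.of fun i j => upperEdges ω i j - strictUpper P i j)} ≤ 1 / n := by
  have hn0 : 0 < n := by omega
  have hn' : (6 : ℝ) ≤ n := by exact_mod_cast hn
  have hlight := measureReal_exists_light_sum_le h0 hp hp0 hp1 hn0
  have hlin := measureReal_exists_pair_le h0 hp hp0.le hp1 hn0 (θ := fun _ => 1)
    fun _ _ _ => zero_le_one
  have hpois := measureReal_exists_pair_le h0 hp hp0.le hp1 hn0
    (θ := fun m => (1 + Real.log (n / m)) / 2) fun m hm hmn => by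
      have : 0 ≤ Real.log (n / m : ℝ) := Real.log_nonneg
        ((one_le_div (by exact_mod_cast hm)).2 (by exact_mod_cast hmn))
      positivity
  have hrow := measureReal_exists_edges_le h0 hp hp0.le hp1 hn0 hnp (S := fun k => {k})
    (T := fun _ => Finset.univ) fun k => by simp
  have hcol := measureReal_exists_edges_le h0 hp hp0.le hp1 hn0 hnp (S := fun _ => Finset.univ)
    (T := fun k => {k}) fun k => by simp
  set E₁ := {ω : Fin n → Fin n → Bool | ∃ u v : Fin n → ℤ, _}
  set E₂ := {ω : Fin n → Fin n → Bool | ∃ S T : Finset (Fin n), S.Nonempty ∧ T.Nonempty ∧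
    p * S.card * T.card * Real.exp 1 + _ < _}
  set E₃ := {ω : Fin n → Fin n → Bool | ∃ S T : Finset (Fin n), S.Nonempty ∧ T.Nonempty ∧
    p * S.card * T.card * Real.exp ((1 + _) / 2) + _ < _}
  set E₄ := {ω : Fin n → Fin n → Bool | ∃ k, _ < ∑ i ∈ {k}, ∑ j, upperEdges ω i j}
  set E₅ := {ω : Fin n → Fin n → Bool | ∃ k, _ < ∑ i, ∑ j ∈ {k}, upperEdges ω i j}
  have hsub : {ω | 560057 * √(n * p) <
      specNorm (Matrix.of fun i j => upperEdges ω i j - strictUpper P i j)} ⊆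
      E₁ ∪ (E₂ ∪ (E₃ ∪ (E₄ ∪ E₅))) := by
    intro ω hω
    by_contra hgood
    simp only [Set.mem_union, not_or] at hgood
    obtain ⟨h1, h2, h3, h4, h5⟩ := hgood
    rw [Set.mem_ofPred_eq] at hω
    refine hω.not_ge ?_
    have hdisc : HasBoundedDiscrepancy (upperEdges ω) p :=
      hasBoundedDiscrepancy_upperEdges (fun k => not_lt.1 fun h => h4 ⟨k, h⟩)
        (fun k => not_lt.1 fun h => h5 ⟨k, h⟩) hp0.le
        (fun S T hS hT => not_lt.1 fun h => h2 ⟨S, T, hS, hT, h⟩)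
        (fun S T hS hT => not_lt.1 fun h => h3 ⟨S, T, hS, hT, h⟩)
    refine (hdisc.specNorm_sub_le hn0 hp0 (strictUpper_nonneg h0) (strictUpper_le hp0.le hp)
      (C := 104) fun u v hu hv => not_lt.1 fun h => h1 ⟨u, v, hu, hv, h⟩).trans (le_of_eq ?_)
    norm_num
  have hexp : Real.exp (-n) ≤ 2 * (1 / n * (1 / n)) := by
    have := Real.pow_div_factorial_le_exp (n : ℝ) (by linarith) 2
    rw [Real.exp_neg]
    refine (inv_anti₀ (by positivity) this).trans (le_of_eq ?_)
    simp [Nat.factorial]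
    field_simp
  have hsum : 6 * (1 / (n : ℝ) * (1 / n)) ≤ 1 / n := by
    rw [← mul_assoc]
    refine mul_le_of_le_one_left (by positivity) ?_
    rw [mul_one_div, div_le_one (by linarith)]
    exact hn'
  have hu := measureReal_mono hsub (measure_ne_top (edgeMeasure P) _)
  have u1 := measureReal_union_le (μ := edgeMeasure P) E₁ (E₂ ∪ (E₃ ∪ (E₄ ∪ E₅)))
  have u2 := measureReal_union_le (μ := edgeMeasure P) E₂ (E₃ ∪ (E₄ ∪ E₅))
  have u3 := measureReal_union_le (μ := edgeMeasure P) E₃ (E₄ ∪ E₅)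
  have u4 := measureReal_union_le (μ := edgeMeasure P) E₄ E₅
  linarith

theorem specNorm_add_transpose_sub_smul_one_le {n : ℕ} (W : Matrix (Fin n) (Fin n) ℝ) {p : ℝ}
    (hp : 0 ≤ p) : specNorm (W + Wᵀ - p • (1 : Matrix (Fin n) (Fin n) ℝ)) ≤
      2 * specNorm W + p := by
  have hW : specNorm Wᵀ = specNorm W := by
    have : Wᵀ = star W := by ext; simp
    rw [specNorm, this, map_star, ContinuousLinearMap.star_eq_adjoint, LinearIsometryEquiv.norm_map,
      specNorm]
  have h1 : ‖(1 : EuclideanSpace ℝ (Fin n) →L[ℝ] EuclideanSpace ℝ (Fin n))‖ ≤ 1 :=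
    ContinuousLinearMap.norm_id_le
  calc specNorm (W + Wᵀ - p • (1 : Matrix (Fin n) (Fin n) ℝ))
      = ‖Matrix.toEuclideanCLM (𝕜 := ℝ) W + Matrix.toEuclideanCLM (𝕜 := ℝ) Wᵀ - p • 1‖ := by
        rw [specNorm, map_sub, map_add, map_smul, map_one]
    _ ≤ specNorm W + specNorm Wᵀ + ‖p • (1 : EuclideanSpace ℝ (Fin n) →L[ℝ] _)‖ :=
        (norm_sub_le _ _).trans (add_le_add_left (norm_add_le _ _) _)
    _ ≤ 2 * specNorm W + p := by
        rw [hW, norm_smul, Real.norm_of_nonneg hp]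
        have := mul_le_mul_of_nonneg_left h1 hp
        linarith

/-- Edge probabilities of the 2-block stochastic block model. -/
def blockProb (n : ℕ) (p q : ℝ) (i j : Fin n) : ℝ :=
  if ((i : ℕ) < n / 2 ↔ (j : ℕ) < n / 2) then p else q

theorem adjM_sub_expAdj {n : ℕ} (p q : ℝ) (ω : Fin n → Fin n → Bool) :
    adjM ω - expAdj n p q =
      (Matrix.of fun i j => upperEdges ω i j - strictUpper (blockProb n p q) i j) +
      (Matrix.of fun i j => upperEdges ω i j - strictUpper (blockProb n p q) i j)ᵀ -
      p • (1 : Matrix (Fin n) (Fin n) ℝ) := by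
  ext i j
  have hsymm : blockProb n p q i j = blockProb n p q j i := by
    simp only [blockProb, iff_comm]
  change (if i = j then 0 else if (if i ≤ j then ω i j else ω j i) then (1 : ℝ) else 0) -
    blockProb n p q i j = (upperEdges ω i j - strictUpper (blockProb n p q) i j) +
    (upperEdges ω j i - strictUpper (blockProb n p q) j i) - p * (1 : Matrix _ _ ℝ) i j
  rcases lt_trichotomy i j with h | rfl | h
  · simp [upperEdges, strictUpper, h, h.ne, h.le, h.not_gt]
  · simp [upperEdges, strictUpper, blockProb]
  · simp [upperEdges, strictUpper, h, h.ne', h.not_ge, h.not_gt, hsymm]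

/-- In the 2-block SBM with `p ≥ Ω(log²n/n)` and `p > q`, the centered
adjacency matrix `R = A - E[A]` satisfies `‖R‖ ≤ O(√(np))` in spectral norm with
probability `1 - n^{-Ω(1)}`. -/
theorem centered_adjacency_spectral_norm :
    ∃ (C₁ C₂ c : ℝ) (n₀ : ℕ), 0 < C₁ ∧ 0 < C₂ ∧ 0 < c ∧
      ∀ (n : ℕ) (p q : ℝ), n₀ ≤ n → Even n → 0 ≤ q → q < p → p ≤ 1 →
        C₁ * (Real.log n) ^ 2 / n ≤ p →
        ENNReal.ofReal (1 - (n : ℝ) ^ (-c)) ≤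
          sbm n p q
            {ω | specNorm (adjM ω - expAdj n p q) ≤ C₂ * Real.sqrt (n * p)} := by
  refine ⟨1, 1120115, 1, 27, by norm_num, by norm_num, by norm_num, ?_⟩
  intro n p q hn _ hq hqp hp1 hlog
  have hp0 : 0 < p := hq.trans_lt hqp
  have hn' : (27 : ℝ) ≤ n := by exact_mod_cast hn
  have hP0 : ∀ i j, 0 ≤ blockProb n p q i j := fun i j => by
    unfold blockProb; split_ifs <;> linarith
  have hP : ∀ i j, blockProb n p q i j ≤ p := fun i j => by
    unfold blockProb; split_ifs <;> linarith
  have hlog3 : 3 ≤ Real.log n := by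
    rw [Real.le_log_iff_exp_le (by linarith), show (3 : ℝ) = (3 : ℕ) * 1 by norm_num,
      Real.exp_nat_mul]
    refine (pow_le_pow_left₀ (Real.exp_pos 1).le Real.exp_one_lt_three.le 3).trans ?_
    linarith
  have hnp : 3 * Real.log n ≤ n * p := by
    rw [one_mul, div_le_iff₀ (by linarith)] at hlog
    have := mul_le_mul_of_nonneg_right hlog3 (by linarith : 0 ≤ Real.log n)
    linarith
  have hps : p ≤ √(n * p) := by
    refine Real.le_sqrt_of_sq_le ?_
    rw [sq]
    exact mul_le_mul_of_nonneg_right (by linarith) hp0.le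
  have hprob : IsProbabilityMeasure (edgeMeasure (blockProb n p q)) := by
    have := fun i j => isProbabilityMeasure_bern (hP0 i j) ((hP i j).trans hp1)
    unfold edgeMeasure
    infer_instance
  have hbad := measureReal_lt_specNorm_le hP0 hP hp0 hp1 (by omega : 6 ≤ n) hnp
  set E := {ω : Fin n → Fin n → Bool | 560057 * √(n * p) <
    specNorm (Matrix.of fun i j => upperEdges ω i j - strictUpper (blockProb n p q) i j)}
  have hcompl : (edgeMeasure (blockProb n p q)).real Eᶜ =
      1 - (edgeMeasure (blockProb n p q)).real E :=
    probReal_compl_eq_one_sub (Set.toFinite E).measurableSet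
  calc ENNReal.ofReal (1 - (n : ℝ) ^ (-1 : ℝ))
      ≤ ENNReal.ofReal ((edgeMeasure (blockProb n p q)).real Eᶜ) := by
        rw [hcompl, Real.rpow_neg_one, ← one_div]
        gcongr
    _ = edgeMeasure (blockProb n p q) Eᶜ := ofReal_measureReal
    _ ≤ sbm n p q {ω | specNorm (adjM ω - expAdj n p q) ≤ 1120115 * √(n * p)} := by
        refine measure_mono fun ω hω => ?_
        rw [Set.mem_compl_iff, Set.mem_ofPred_eq, not_lt] at hω
        rw [Set.mem_ofPred_eq, adjM_sub_expAdj]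
        refine (specNorm_add_transpose_sub_smul_one_le _ hp0.le).trans ?_
        linarith
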